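/- arXiv:1207.5004 — 3 statements merged into one kernel-verified Lean document; each statement's English description precedes it below -/
import Mathlib

section
/- A set P ⊆ A^ℕ is a path set satisfying σ '' P ⊆ P (a shift-invariant path set) if and only if P is a one-sided sofic shift. -/
/-- The path set presented by the pointed graph with edge relation `E` and
distinguished vertex `v0`: all label sequences of infinite walks from `v0`. -/
def pathSet {A V : Type*} (E : V → A → V → Prop) (v0 : V) : Set (ℕ → A) :=
  {x | ∃ p : ℕ → V, p 0 = v0 ∧ ∀ n, E (p n) (x n) (p (n + 1))}

/-- A set `P ⊆ A^ℕ` is a path set if it is presented by some pointed graph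
with a finite vertex type. -/
def IsPathSet {A : Type*} [Fintype A] (P : Set (ℕ → A)) : Prop :=
  ∃ (V : Type) (_ : Fintype V) (E : V → A → V → Prop) (v0 : V), P = pathSet E v0

/-- The one-sided shift map `σ`. -/
def shift {A : Type*} (x : ℕ → A) : ℕ → A := fun n => x (n + 1)

/-- A one-sided sofic shift: the set of label sequences of all one-sided infinite
walks in a finite labeled graph, starting from any vertex. -/
def IsOneSidedSofic {A : Type*} [Fintype A] (Y : Set (ℕ → A)) : Prop :=
  ∃ (V : Type) (_ : Fintype V) (E : V → A → V → Prop), Y = ⋃ v : V, pathSet E v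

theorem shift_mem_pathSet {A V : Type*} {E : V → A → V → Prop} {p : ℕ → V} {x : ℕ → A}
    (hp : ∀ n, E (p n) (x n) (p (n + 1))) : shift x ∈ pathSet E (p 1) :=
  ⟨fun n => p (n + 1), rfl, fun n => hp (n + 1)⟩

/-- Prepending an edge to a walk. -/
theorem mem_pathSet_of_edge {A V : Type*} {E : V → A → V → Prop} {v w : V} {x : ℕ → A}
    (hE : E v (x 0) w) (hx : shift x ∈ pathSet E w) : x ∈ pathSet E v := by
  obtain ⟨p, hp0, hp⟩ := hx
  refine ⟨fun n => Nat.casesOn n v p, rfl, ?_⟩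
  rintro (_ | n)
  · simpa [hp0] using hE
  · exact hp n

/-- In a shift-invariant set `P`, the vertices whose path set lies in `P` are closed under
following edges. -/
theorem pathSet_subset_of_edge {A V : Type*} {E : V → A → V → Prop} {P : Set (ℕ → A)}
    (hP : shift '' P ⊆ P) {v w : V} {a : A} (hE : E v a w) (hv : pathSet E v ⊆ P) :
    pathSet E w ⊆ P := by
  intro x hx
  let y : ℕ → A := fun n => Nat.casesOn n a x
  have hy : y ∈ pathSet E v := mem_pathSet_of_edge (x := y) hE hx
  exact hP ⟨y, hv hy, rfl⟩

theorem IsPathSet.isOneSidedSofic {A : Type*} [Fintype A] {P : Set (ℕ → A)}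
    (h : IsPathSet P) (hP : shift '' P ⊆ P) : IsOneSidedSofic P := by
  classical
  obtain ⟨V, _, E, v0, hV⟩ := h
  refine ⟨{v : V // pathSet E v ⊆ P}, inferInstance, fun v a w => E v a w, ?_⟩
  ext x
  rw [Set.mem_iUnion]
  constructor
  · intro hx
    rw [hV] at hx
    obtain ⟨p, hp0, hp⟩ := hx
    have hmem : ∀ n, pathSet E (p n) ⊆ P := by
      intro n
      induction n with
      | zero => rw [hp0, hV]
      | succ n ih => exact pathSet_subset_of_edge hP (hp n) ih
    exact ⟨⟨p 0, hmem 0⟩, fun n => ⟨p n, hmem n⟩, rfl, hp⟩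
  · rintro ⟨v, p, hp0, hp⟩
    exact v.2 ⟨fun n => p n, congrArg Subtype.val hp0, hp⟩

/-- The graph obtained by adjoining a source vertex `none` carrying a copy of every edge. -/
def sourceGraph {A V : Type*} (E : V → A → V → Prop) (s : Option V) (a : A) (t : Option V) :
    Prop :=
  ∃ v w, (s = none ∨ s = some v) ∧ t = some w ∧ E v a w

theorem pathSet_sourceGraph_none {A V : Type*} (E : V → A → V → Prop) :
    pathSet (sourceGraph E) none = ⋃ v, pathSet E v := by
  ext x
  rw [Set.mem_iUnion]
  constructor
  · rintro ⟨p, -, hp⟩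
    choose v w hv hw hE using hp
    have hvw : ∀ n, v (n + 1) = w n := fun n => by
      simpa [hw n, eq_comm] using hv (n + 1)
    exact ⟨v 0, v, rfl, fun n => by rw [hvw]; exact hE n⟩
  · rintro ⟨v, p, -, hp⟩
    refine mem_pathSet_of_edge (w := some (p 1)) ⟨p 0, p 1, Or.inl rfl, rfl, hp 0⟩ ?_
    exact ⟨fun n => some (p (n + 1)), rfl,
      fun n => ⟨p (n + 1), p (n + 2), Or.inr rfl, rfl, hp (n + 1)⟩⟩

theorem IsOneSidedSofic.isPathSet {A : Type*} [Fintype A] {P : Set (ℕ → A)}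
    (h : IsOneSidedSofic P) : IsPathSet P := by
  obtain ⟨V, _, E, rfl⟩ := h
  exact ⟨Option V, inferInstance, sourceGraph E, none, (pathSet_sourceGraph_none E).symm⟩

theorem IsOneSidedSofic.image_shift_subset {A : Type*} [Fintype A] {P : Set (ℕ → A)}
    (h : IsOneSidedSofic P) : shift '' P ⊆ P := by
  obtain ⟨V, _, E, rfl⟩ := h
  rintro _ ⟨x, hx, rfl⟩
  obtain ⟨v, p, -, hp⟩ := Set.mem_iUnion.1 hx
  exact Set.mem_iUnion.2 ⟨p 1, shift_mem_pathSet hp⟩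

/-- A set is a shift-invariant path set if and only if it is a one-sided sofic shift. -/
theorem isPathSet_shiftInvariant_iff_sofic {A : Type} [Fintype A]
    (P : Set (ℕ → A)) :
    (IsPathSet P ∧ shift '' P ⊆ P) ↔ IsOneSidedSofic P :=
  ⟨fun h => h.1.isOneSidedSofic h.2, fun h => ⟨h.isPathSet, h.image_shift_subset⟩⟩
end

section
/- Let (V, E) be a finite labeled graph over A in which every vertex has at least one outgoing edge (for every v : V there exist a and w with E v a w). Let H be the subset-construction graph: its vertices are the nonempty subsets S ⊆ V, and there is an edge labeled a from S to S′ exactly when S′ = {w : ∃ v ∈ S, E v a w} and S′ is nonempty. Then for every nonempty subset S ⊆ V, the path set of H at S equals the union of the path sets of (V, E) at the members of S: X_H(S) = ⋃_{v ∈ S} X_{(V,E)}(v). -/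
/-- The subset-construction graph: vertices are the nonempty subsets of `V`, and
there is an edge labeled `a` from `S` to `S'` exactly when `S'` is the
(nonempty) set of all vertices reachable from members of `S` along an edge
labeled `a`. -/
def subsetEdge {A V : Type*} (E : V → A → V → Prop) :
    {S : Set V // S.Nonempty} → A → {S : Set V // S.Nonempty} → Prop :=
  fun S a S' => (S' : Set V) = {w | ∃ v ∈ (S : Set V), E v a w}

/-- `HasWalk E x k n v`: there is a walk of length `k` starting at `v` whose labels are
`x n, …, x (n + k - 1)`. -/
def HasWalk {A V : Type*} (E : V → A → V → Prop) (x : ℕ → A) : ℕ → ℕ → V → Prop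
  | 0, _, _ => True
  | k + 1, n, v => ∃ w, E v (x n) w ∧ HasWalk E x k (n + 1) w

theorem HasWalk.of_succ {A V : Type*} {E : V → A → V → Prop} {x : ℕ → A} {k n : ℕ} {v : V}
    (h : HasWalk E x (k + 1) n v) : HasWalk E x k n v := by
  induction k generalizing n v with
  | zero => trivial
  | succ k ih =>
    obtain ⟨w, hw, h⟩ := h
    exact ⟨w, hw, ih h⟩

theorem HasWalk.antitone {A V : Type*} (E : V → A → V → Prop) (x : ℕ → A) (n : ℕ) (v : V) :
    Antitone fun k => HasWalk E x k n v :=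
  antitone_nat_of_succ_le fun _ => HasWalk.of_succ

/-- A decreasing sequence of nonempty predicates on a finite type has a common witness. -/
theorem exists_forall_of_antitone {V : Type*} [Finite V] {P : ℕ → V → Prop}
    (hanti : ∀ v, Antitone fun k => P k v) (h : ∀ k, ∃ v, P k v) : ∃ v, ∀ k, P k v := by
  have := Fintype.ofFinite V
  by_contra! hne
  choose k hk using hne
  obtain ⟨v, hv⟩ := h (Finset.univ.sup k)
  exact hk v (hanti v (Finset.le_sup (Finset.mem_univ v)) hv)

/-- Kőnig's lemma: in a finite graph, a vertex at which walks of every finite length follow `x`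
is the start of an infinite walk labeled `x`. -/
theorem mem_pathSet_of_forall_hasWalk {A V : Type*} [Finite V] {E : V → A → V → Prop}
    {x : ℕ → A} {v : V} (h : ∀ k, HasWalk E x k 0 v) : x ∈ pathSet E v := by
  have step : ∀ n (u : {u : V // ∀ k, HasWalk E x k n u}),
      ∃ w : {w : V // ∀ k, HasWalk E x k (n + 1) w}, E u (x n) w := by
    rintro n ⟨u, hu⟩
    obtain ⟨w, hw⟩ := exists_forall_of_antitone
      (P := fun k w => E u (x n) w ∧ HasWalk E x k (n + 1) w)
      (fun w _ _ hkl hP => ⟨hP.1, HasWalk.antitone E x (n + 1) w hkl hP.2⟩)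
      (fun k => hu (k + 1))
    exact ⟨⟨w, fun k => (hw k).2⟩, (hw 0).1⟩
  choose next hnext using step
  let q : ∀ n, {u : V // ∀ k, HasWalk E x k n u} := fun n => Nat.rec ⟨v, h⟩ next n
  have hq : ∀ n : ℕ, E (q n).1 (x n) (q (n + 1)).1 := fun n => hnext n (q n)
  exact ⟨fun n => (q n).1, rfl, hq⟩

theorem exists_hasWalk_of_subsetEdge {A V : Type*} {E : V → A → V → Prop} {x : ℕ → A}
    {p : ℕ → {S : Set V // S.Nonempty}} (hp : ∀ n, subsetEdge E (p n) (x n) (p (n + 1)))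
    (k n : ℕ) : ∃ v ∈ (p n : Set V), HasWalk E x k n v := by
  induction k generalizing n with
  | zero =>
    obtain ⟨v, hv⟩ := (p n).2
    exact ⟨v, hv, trivial⟩
  | succ k ih =>
    obtain ⟨w, hw, hwalk⟩ := ih (n + 1)
    have hmem : w ∈ {w | ∃ v ∈ (p n : Set V), E v (x n) w} := hp n ▸ hw
    obtain ⟨v, hv, hE⟩ := hmem
    exact ⟨v, hv, w, hE, hwalk⟩

theorem pathSet_subset_pathSet_subsetEdge {A V : Type*} {E : V → A → V → Prop}
    (S : {S : Set V // S.Nonempty}) {v : V} (hv : v ∈ (S : Set V)) :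
    pathSet E v ⊆ pathSet (subsetEdge E) S := by
  rintro x ⟨p, rfl, hp⟩
  let T : ℕ → Set V := fun n => Nat.rec (S : Set V) (fun n U => {w | ∃ v ∈ U, E v (x n) w}) n
  have hT : ∀ n, p n ∈ T n := by
    intro n
    induction n with
    | zero => exact hv
    | succ n ih => exact ⟨p n, ih, hp n⟩
  exact ⟨fun n => ⟨T n, p n, hT n⟩, rfl, fun _ => rfl⟩

/-- For a finite labeled graph in which every vertex has an outgoing edge, the path
set of the subset-construction graph at a nonempty subset `S` equals the union of
the path sets of the original graph at the members of `S`. -/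
theorem pathSet_subset_construction {A : Type} [Fintype A] {V : Type} [Fintype V]
    (E : V → A → V → Prop) (hout : ∀ v : V, ∃ a w, E v a w)
    (S : {S : Set V // S.Nonempty}) :
    pathSet (subsetEdge E) S = ⋃ v ∈ (S : Set V), pathSet E v := by
  apply Set.Subset.antisymm
  · rintro x ⟨p, rfl, hp⟩
    obtain ⟨v, hv⟩ := exists_forall_of_antitone
      (P := fun k v => v ∈ (p 0 : Set V) ∧ HasWalk E x k 0 v)
      (fun v _ _ hkl hP => ⟨hP.1, HasWalk.antitone E x 0 v hkl hP.2⟩)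
      (fun k => exists_hasWalk_of_subsetEdge hp k 0)
    exact Set.mem_biUnion (hv 0).1 (mem_pathSet_of_forall_hasWalk fun k => (hv k).2)
  · exact Set.iUnion₂_subset fun v hv => pathSet_subset_pathSet_subsetEdge S hv
end

section
/- For any path set P ⊆ A^ℕ and any j ≥ 0 and m ≥ 1, the decimated set ψ_{j,m} '' P = {ψ_{j,m}(x) : x ∈ P} is a path set. -/
/-- The decimation map `ψ_{j,m}`, extracting the digits in the arithmetic
progression `j, j+m, j+2m, …`. -/
def decimate {A : Type*} (j m : ℕ) (x : ℕ → A) : ℕ → A := fun n => x (j + n * m)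

/-- `IsWalk E n x p` says that the first `n` steps of the vertex sequence `p` form a walk
with labels given by `x`. -/
def IsWalk {A V : Type*} (E : V → A → V → Prop) (n : ℕ) (x : ℕ → A) (p : ℕ → V) : Prop :=
  ∀ i < n, E (p i) (x i) (p (i + 1))

/-- The `m`-step edge relation: a walk of length `m`, labeled by its first label. -/
def stepRel {A V : Type*} (E : V → A → V → Prop) (m : ℕ) (u : V) (a : A) (w : V) : Prop :=
  ∃ x p, x 0 = a ∧ p 0 = u ∧ p m = w ∧ IsWalk E m x p

/-- The vertices reached from `v0` by a walk of length `j`. -/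
def reachSet {A V : Type*} (E : V → A → V → Prop) (j : ℕ) (v0 : V) : Set V :=
  {u | ∃ x p, p 0 = v0 ∧ p j = u ∧ IsWalk E j x p}

theorem decimate_zero_image_pathSet {A V : Type*} (E : V → A → V → Prop) (v0 : V) {m : ℕ}
    (hm : 1 ≤ m) : decimate 0 m '' pathSet E v0 = pathSet (stepRel E m) v0 := by
  ext y
  constructor
  · rintro ⟨x, ⟨p, hp0, hp⟩, rfl⟩
    refine ⟨fun n => p (n * m), by simpa using hp0, fun n =>
      ⟨fun i => x (n * m + i), fun i => p (n * m + i), by simp [decimate], rfl, ?_,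
        fun i _ => hp (n * m + i)⟩⟩
    simp only [add_mul, one_mul]
  · rintro ⟨q, hq0, hq⟩
    choose x s hx hs0 hsm hs using hq
    refine ⟨fun t => x (t / m) (t % m), ⟨fun t => s (t / m) (t % m), ?_, fun t => ?_⟩, ?_⟩
    · simp [hs0, hq0]
    · have hlt : t % m < m := Nat.mod_lt _ hm
      have key := hs (t / m) (t % m) hlt
      have ht := Nat.div_add_mod t m
      have hnext : s ((t + 1) / m) ((t + 1) % m) = s (t / m) (t % m + 1) := by
        rcases (Nat.succ_le_of_lt hlt).lt_or_eq with h | h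
        · obtain ⟨h1, h2⟩ := (Nat.div_mod_unique (a := t + 1) (d := t / m) (c := t % m + 1) hm).2
            ⟨by omega, h⟩
          rw [h1, h2]
        · obtain ⟨h1, h2⟩ := (Nat.div_mod_unique (a := t + 1) (d := t / m + 1) (c := 0) hm).2
            ⟨by rw [mul_add, mul_one]; omega, hm⟩
          rw [h1, h2, hs0, ← hsm]
          exact congrArg _ h.symm
      simpa only [hnext] using key
    · funext n
      simp [decimate, Nat.mul_div_cancel n hm, hx]

theorem decimate_one_image_pathSet {A V : Type*} (E : V → A → V → Prop) (v0 : V) (j : ℕ) :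
    decimate j 1 '' pathSet E v0 = ⋃ u ∈ reachSet E j v0, pathSet E u := by
  ext y
  simp only [Set.mem_iUnion, exists_prop]
  constructor
  · rintro ⟨x, ⟨p, hp0, hp⟩, rfl⟩
    refine ⟨p j, ⟨x, p, hp0, rfl, fun i _ => hp i⟩, fun n => p (j + n), rfl, fun n => ?_⟩
    simpa [decimate, add_assoc] using hp (j + n)
  · rintro ⟨u, ⟨x, p, hp0, hpj, hp⟩, q, hq0, hq⟩
    refine ⟨fun t => if t < j then x t else y (t - j),
      ⟨fun t => if t < j then p t else q (t - j), ?_, fun t => ?_⟩, ?_⟩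
    · rcases Nat.eq_zero_or_pos j with rfl | h
      · simp [hq0, ← hpj, hp0]
      · simp [h, hp0]
    · rcases lt_trichotomy (t + 1) j with h | h | h
      · simpa [h, (Nat.lt_succ_self t).trans h] using hp t (by omega)
      · subst h
        simpa [hq0, ← hpj] using hp t (Nat.lt_succ_self t)
      · have h1 : ¬ t < j := by omega
        have h2 : ¬ t + 1 < j := by omega
        have h3 : t + 1 - j = t - j + 1 := by omega
        simpa only [h1, h2, h3, if_false] using hq (t - j)
    · funext n
      simp [decimate]

/-- A union of path sets presented by a single finite graph is a path set. -/
theorem isPathSet_biUnion_pathSet {A V : Type} [Fintype A] [Fintype V] (E : V → A → V → Prop)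
    (S : Set V) : IsPathSet (⋃ u ∈ S, pathSet E u) := by
  refine ⟨Option V, inferInstance,
    fun o a o' => ∃ w, o' = some w ∧ ∃ u, (o = some u ∨ o = none ∧ u ∈ S) ∧ E u a w, none, ?_⟩
  ext y
  simp only [Set.mem_iUnion, exists_prop]
  constructor
  · rintro ⟨u, hu, p, hp0, hp⟩
    refine ⟨fun n => if n = 0 then none else some (p n), rfl,
      fun n => ⟨p (n + 1), rfl, p n, ?_, hp n⟩⟩
    rcases n with _ | n
    · exact Or.inr ⟨rfl, hp0 ▸ hu⟩
    · exact Or.inl rfl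
  · rintro ⟨q, hq0, hq⟩
    choose w hw u hu hE using hq
    have hsucc (n : ℕ) : u (n + 1) = w n := by
      rcases hu (n + 1) with h | ⟨h, -⟩
      · exact Option.some_injective _ (h.symm.trans (hw n))
      · simp [hw n] at h
    refine ⟨u 0, ?_, u, rfl, fun n => hsucc n ▸ hE n⟩
    rcases hu 0 with h | ⟨-, h⟩
    · simp [hq0] at h
    · exact h

theorem decimate_zero_comp_decimate_one {A : Type*} (j m : ℕ) :
    (decimate j m : (ℕ → A) → ℕ → A) = decimate 0 m ∘ decimate j 1 := by
  funext x n
  simp [decimate]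

/-- The decimation of a path set is a path set. -/
theorem isPathSet_decimate {A : Type} [Fintype A] (P : Set (ℕ → A))
    (hP : IsPathSet P) (j m : ℕ) (hm : 1 ≤ m) :
    IsPathSet (decimate j m '' P) := by
  obtain ⟨V, _, E, v0, rfl⟩ := hP
  rw [decimate_zero_comp_decimate_one, Set.image_comp, decimate_one_image_pathSet]
  simp only [Set.image_iUnion, decimate_zero_image_pathSet E _ hm]
  exact isPathSet_biUnion_pathSet _ _
end
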